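/- Let G be 3-edge-connected with DFS tree T rooted at r. Let v ≠ r be an ancestor of a vertex u such that m = M(u) satisfies m ∈ {M̃(v), M_low1(v), M_low2(v)}. Then v ∈ V(u) if and only if u is the minimum vertex in M⁻¹(m) greater than v, high(u) < v, and b_count(v) = b_count(u) + 1. -/

import Mathlib

/-- An undirected multigraph `G` (parallel edges allowed, no self-loops) together with a
DFS spanning tree `T` rooted at `root`, where the vertices are identified with their DFS
preorder numbers (so they are `Fin n`, and the root gets the smallest number).
Tree edges are oriented from child to parent and back-edges from descendant to
(proper) ancestor. -/
structure DFSGraph where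
  /-- number of vertices; the vertices are `Fin n`, numbered in DFS preorder -/
  n : ℕ
  /-- the type indexing the edges (parallel edges are allowed) -/
  Edge : Type
  edgeFintype : Fintype Edge
  /-- the first endpoint (the descendant end) of each edge -/
  fst : Edge → Fin n
  /-- the second endpoint (the ancestor end) of each edge -/
  snd : Edge → Fin n
  /-- no self-loops -/
  noloop : ∀ e, fst e ≠ snd e
  /-- the root `r` of the DFS tree -/
  root : Fin n
  /-- in DFS preorder the root gets the smallest number -/
  root_le : ∀ v, root ≤ v
  /-- the parent function `p` of the DFS tree (arbitrary at the root) -/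
  parent : Fin n → Fin n
  /-- the parent of a non-root vertex precedes it in preorder -/
  parent_lt : ∀ v, v ≠ root → parent v < v
  /-- `tEdge v` is the tree edge `(v, p(v))`, for `v ≠ root` -/
  tEdge : Fin n → Edge
  tEdge_fst : ∀ v, v ≠ root → fst (tEdge v) = v
  tEdge_snd : ∀ v, v ≠ root → snd (tEdge v) = parent v
  tEdge_inj : ∀ u v, u ≠ root → v ≠ root → tEdge u = tEdge v → u = v
  /-- DFS property: every non-tree edge is a back-edge, i.e. it joins a vertex to an
  ancestor of it (a proper ancestor, by `noloop`) -/
  back_anc : ∀ e, (¬ ∃ v, v ≠ root ∧ e = tEdge v) →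
    Relation.ReflTransGen (fun x y => x ≠ root ∧ y = parent x) (fst e) (snd e)
  /-- preorder property: the descendants of any vertex form an interval of preorder
  numbers starting at that vertex -/
  preorder_interval : ∀ v u w : Fin n, v ≤ u → u ≤ w →
    Relation.ReflTransGen (fun x y => x ≠ root ∧ y = parent x) w v →
    Relation.ReflTransGen (fun x y => x ≠ root ∧ y = parent x) u v

namespace DFSGraph

variable (G : DFSGraph)

/-- `Anc a b`: `a` is an ancestor of `b` in `T` (every vertex is an ancestor of itself). -/
def Anc (a b : Fin G.n) : Prop :=
  Relation.ReflTransGen (fun x y => x ≠ G.root ∧ y = G.parent x) b a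

/-- `PAnc a b`: `a` is a proper ancestor of `b` in `T`. -/
def PAnc (a b : Fin G.n) : Prop := G.Anc a b ∧ a ≠ b

/-- `e` is an edge of the spanning tree `T`. -/
def IsTreeEdge (e : G.Edge) : Prop := ∃ v, v ≠ G.root ∧ e = G.tEdge v

/-- `e` is a back-edge (an edge of `G ∖ T`). -/
def IsBack (e : G.Edge) : Prop := ¬ G.IsTreeEdge e

/-- `B v`: the set of back-edges `(x, y)` with `x` a descendant of `v` and `y` a proper
ancestor of `v`. -/
def B (v : Fin G.n) : Set G.Edge :=
  {e | G.IsBack e ∧ G.Anc v (G.fst e) ∧ G.PAnc (G.snd e) v}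

/-- `b_count(v) = |B(v)|`. -/
noncomputable def bcount (v : Fin G.n) : ℕ := (G.B v).ncard

/-- adjacency in `G` after removing the edge set `S` -/
def AdjOff (S : Set G.Edge) (x y : Fin G.n) : Prop :=
  ∃ e, e ∉ S ∧ ((G.fst e = x ∧ G.snd e = y) ∨ (G.fst e = y ∧ G.snd e = x))

/-- `G ∖ S` is connected -/
def ConnectedOff (S : Set G.Edge) : Prop :=
  ∀ x y, Relation.ReflTransGen (G.AdjOff S) x y

/-- `S` is an edge cut of `G`: removing `S` disconnects `G`. -/
def IsCut (S : Set G.Edge) : Prop := ¬ G.ConnectedOff S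

/-- `G` is `k`-edge-connected: it has no cut of fewer than `k` edges. -/
def EdgeConn (k : ℕ) : Prop := ∀ S : Set G.Edge, S.ncard < k → ¬ G.IsCut S

/-- `IsLow1 v y`: `y = low1(v) = min {y | ∃ (x,y) ∈ B(v)}`. -/
def IsLow1 (v y : Fin G.n) : Prop :=
  (∃ e ∈ G.B v, G.snd e = y) ∧ ∀ e ∈ G.B v, y ≤ G.snd e

/-- `IsHigh v y`: `y = high(v) = max {y | ∃ (x,y) ∈ B(v)}`. -/
def IsHigh (v y : Fin G.n) : Prop :=
  (∃ e ∈ G.B v, G.snd e = y) ∧ ∀ e ∈ G.B v, G.snd e ≤ y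

/-- `IsLow2 v y`: `y = low2(v)`, the minimum lower end of the back-edges in `B(v)` minus
one (fixed, but arbitrary) back-edge `(low1D(v), low1(v))` attaining `low1(v)`. -/
def IsLow2 (v y : Fin G.n) : Prop :=
  ∃ f ∈ G.B v, (∀ g ∈ G.B v, G.snd f ≤ G.snd g) ∧
    (∃ e ∈ G.B v, e ≠ f ∧ G.snd e = y) ∧
    (∀ e ∈ G.B v, e ≠ f → y ≤ G.snd e)

/-- `IsL1 v y`: `y = l1(v) = min ({y | (v,y) is a back-edge} ∪ {v})`. -/
def IsL1 (v y : Fin G.n) : Prop :=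
  (y = v ∨ ∃ e, G.IsBack e ∧ G.fst e = v ∧ G.snd e = y) ∧
  y ≤ v ∧ (∀ e, G.IsBack e → G.fst e = v → y ≤ G.snd e)

/-- `IsL2 v y`: `y = l2(v)`, defined as `l1(v)` but after removing one (fixed, but
arbitrary) back-edge `(v, l1(v))` attaining `l1(v)`, if such a back-edge exists. -/
def IsL2 (v y : Fin G.n) : Prop :=
  ((¬ ∃ e, G.IsBack e ∧ G.fst e = v) ∧ y = v) ∨
  (∃ f, G.IsBack f ∧ G.fst f = v ∧
    (∀ g, G.IsBack g → G.fst g = v → G.snd f ≤ G.snd g) ∧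
    (y = v ∨ ∃ e, G.IsBack e ∧ G.fst e = v ∧ e ≠ f ∧ G.snd e = y) ∧
    y ≤ v ∧
    (∀ e, G.IsBack e → G.fst e = v → e ≠ f → y ≤ G.snd e))

/-- `z` is the nearest common ancestor of the set of vertices `S`. -/
def IsNCA (S : Set (Fin G.n)) (z : Fin G.n) : Prop :=
  (∀ x ∈ S, G.Anc z x) ∧ ∀ z', (∀ x ∈ S, G.Anc z' x) → G.Anc z' z

/-- `IsM v m`: `m = M(v)`, the nearest common ancestor of all higher ends of back-edges
in `B(v)`. -/
def IsM (v m : Fin G.n) : Prop :=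
  G.IsNCA {x | ∃ e ∈ G.B v, G.fst e = x} m

/-- `IsMtilde v m`: `m = M̃(v)`, the nearest common ancestor of all higher ends of
back-edges in `B(v)` that are proper descendants of `M(v)` (defined only if such a
higher end exists). -/
def IsMtilde (v m : Fin G.n) : Prop :=
  ∃ mv, G.IsM v mv ∧
    {x | ∃ e ∈ G.B v, G.fst e = x ∧ G.PAnc mv x}.Nonempty ∧
    G.IsNCA {x | ∃ e ∈ G.B v, G.fst e = x ∧ G.PAnc mv x} m

/-- `c` is a child of `p` in `T`. -/
def IsChild (p c : Fin G.n) : Prop := c ≠ G.root ∧ G.parent c = p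

/-- `low1(c) ≤ low1(c')` (stated relationally). -/
def Low1LE (c c' : Fin G.n) : Prop :=
  ∀ y y', G.IsLow1 c y → G.IsLow1 c' y' → y ≤ y'

/-- `c = c₁(p)`: `c` is a `low1` child of `p`, i.e. a child of `p` minimizing `low1`. -/
def IsC1 (p c : Fin G.n) : Prop :=
  G.IsChild p c ∧ ∀ c', G.IsChild p c' → G.Low1LE c c'

/-- `c = c₂(p)`: `c` is a `low2` child of `p`, i.e. a child of `p` minimizing `low1`
among the children different from the (fixed) `low1` child. -/
def IsC2 (p c : Fin G.n) : Prop :=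
  ∃ c1, G.IsC1 p c1 ∧ G.IsChild p c ∧ c ≠ c1 ∧
    ∀ c', G.IsChild p c' → c' ≠ c1 → G.Low1LE c c'

/-- `c = c₃(p)`: `c` is a `low3` child of `p`. -/
def IsC3 (p c : Fin G.n) : Prop :=
  ∃ c1 c2, G.IsC1 p c1 ∧
    (G.IsChild p c2 ∧ c2 ≠ c1 ∧ ∀ c', G.IsChild p c' → c' ≠ c1 → G.Low1LE c2 c') ∧
    G.IsChild p c ∧ c ≠ c1 ∧ c ≠ c2 ∧
    (∀ c', G.IsChild p c' → c' ≠ c1 → c' ≠ c2 → G.Low1LE c c')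

/-- `IsMlow1 v m`: `m = M_low1(v)`, the nearest common ancestor of all higher ends of
back-edges in `B(v)` that are descendants of the `low1` child of `M(v)` (defined only
if such a higher end exists). -/
def IsMlow1 (v m : Fin G.n) : Prop :=
  ∃ mv c1, G.IsM v mv ∧ G.IsC1 mv c1 ∧
    {x | ∃ e ∈ G.B v, G.fst e = x ∧ G.Anc c1 x}.Nonempty ∧
    G.IsNCA {x | ∃ e ∈ G.B v, G.fst e = x ∧ G.Anc c1 x} m

/-- `IsMlow2 v m`: `m = M_low2(v)`, the nearest common ancestor of all higher ends of
back-edges in `B(v)` that are descendants of the `low2` child of `M(v)` (defined only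
if such a higher end exists). -/
def IsMlow2 (v m : Fin G.n) : Prop :=
  ∃ mv c2, G.IsM v mv ∧ G.IsC2 mv c2 ∧
    {x | ∃ e ∈ G.B v, G.fst e = x ∧ G.Anc c2 x}.Nonempty ∧
    G.IsNCA {x | ∃ e ∈ G.B v, G.fst e = x ∧ G.Anc c2 x} m

/-- `IsNextM v w`: `w = nextM(v)`, the maximum vertex `w < v` with `M(w) = M(v)`. -/
def IsNextM (v w : Fin G.n) : Prop :=
  ∃ m, G.IsM v m ∧ G.IsM w m ∧ w < v ∧ ∀ w', w' < v → G.IsM w' m → w' ≤ w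

/-- `IsLowM v l`: `l = low_M(v) = min {y | ∃ (x,y) ∈ B(v) ∖ B(nextM(v))}`. -/
def IsLowM (v l : Fin G.n) : Prop :=
  ∃ w, G.IsNextM v w ∧ (∃ e ∈ G.B v, e ∉ G.B w ∧ G.snd e = l) ∧
    ∀ e ∈ G.B v, e ∉ G.B w → l ≤ G.snd e

end DFSGraph

namespace DFSGraph

variable {G : DFSGraph}

theorem Anc.le {a b : Fin G.n} (h : G.Anc a b) : a ≤ b := by
  unfold Anc at h
  induction h with
  | refl => exact le_rfl
  | tail _ hbc ih =>
    obtain ⟨hb, rfl⟩ := hbc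
    exact (G.parent_lt _ hb).le.trans ih

theorem Anc.of_le {a b c : Fin G.n} (hac : G.Anc a c) (hbc : G.Anc b c) (hab : a ≤ b) :
    G.Anc a b :=
  G.preorder_interval a b c hab hbc.le hac

theorem Anc.trans {a b c : Fin G.n} (hab : G.Anc a b) (hbc : G.Anc b c) : G.Anc a c :=
  Relation.ReflTransGen.trans hbc hab

theorem anc_parent {w : Fin G.n} (hw : w ≠ G.root) : G.Anc (G.parent w) w :=
  Relation.ReflTransGen.single ⟨hw, rfl⟩

theorem Anc.parent {a w : Fin G.n} (h : G.Anc a w) (hne : w ≠ a) : G.Anc a (G.parent w) := by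
  rcases Relation.ReflTransGen.cases_head h with h | ⟨c, ⟨_, rfl⟩, hc⟩
  · exact absurd h hne
  · exact hc

theorem not_anc_of_lt {a b : Fin G.n} (h : b < a) : ¬ G.Anc a b :=
  fun hab => h.not_ge hab.le

theorem anc_fst_iff_anc_snd {u : Fin G.n} {e : G.Edge} (ht : e ≠ G.tEdge u) (hB : e ∉ G.B u) :
    G.Anc u (G.fst e) ↔ G.Anc u (G.snd e) := by
  by_cases hT : G.IsTreeEdge e
  · obtain ⟨w, hw, rfl⟩ := hT
    rw [G.tEdge_fst w hw, G.tEdge_snd w hw]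
    exact ⟨fun h => h.parent fun hwu => ht (by rw [hwu]), fun h => h.trans (anc_parent hw)⟩
  · have hanc : G.Anc (G.snd e) (G.fst e) := G.back_anc e hT
    refine ⟨fun h => ?_, fun h => h.trans hanc⟩
    rcases le_or_gt u (G.snd e) with hle | hlt
    · exact h.of_le hanc hle
    · exact absurd ⟨hT, h, hanc.of_le h hlt.le, hlt.ne⟩ hB

/-- If a vertex predicate is nonconstant and changes only across edges of `S`, then `S` is a
cut. -/
theorem isCut_of_separates {S : Set G.Edge} (P : Fin G.n → Prop)
    (hS : ∀ e, e ∉ S → (P (G.fst e) ↔ P (G.snd e))) {a b : Fin G.n} (ha : P a) (hb : ¬ P b) :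
    G.IsCut S := by
  intro hconn
  have key : ∀ x, Relation.ReflTransGen (G.AdjOff S) a x → P x := by
    intro x hx
    induction hx with
    | refl => exact ha
    | tail _ hadj ih =>
      obtain ⟨e, he, ⟨rfl, rfl⟩ | ⟨rfl, rfl⟩⟩ := hadj
      · exact (hS e he).1 ih
      · exact (hS e he).2 ih
  exact hb (key b (hconn a b))

theorem B_nonempty (h2 : G.EdgeConn 2) {u : Fin G.n} (hu : u ≠ G.root) : (G.B u).Nonempty := by
  by_contra! hB
  refine h2 {G.tEdge u} (by simp) (isCut_of_separates (G.Anc u) (fun e he => ?_)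
    (a := u) (b := G.root) Relation.ReflTransGen.refl
    (not_anc_of_lt (lt_of_le_of_ne (G.root_le u) hu.symm)))
  exact anc_fst_iff_anc_snd he (by simp [hB])

/-- In a `3`-edge-connected graph, distinct nonroot vertices have distinct sets `B`. -/
theorem B_ne_of_lt (h3 : G.EdgeConn 3) {w u : Fin G.n} (hw : w ≠ G.root) (hlt : w < u) :
    G.B w ≠ G.B u := by
  intro hB
  refine h3 {G.tEdge w, G.tEdge u} ((Set.ncard_insert_le _ _).trans_lt (by simp))
    (isCut_of_separates (fun x => G.Anc w x ∧ ¬ G.Anc u x) (fun e he => ?_)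
      (a := w) (b := G.root) ⟨Relation.ReflTransGen.refl, not_anc_of_lt hlt⟩
      fun h => not_anc_of_lt (lt_of_le_of_ne (G.root_le w) hw.symm) h.1)
  simp only [Set.mem_insert_iff, Set.mem_singleton_iff, not_or] at he
  by_cases heB : e ∈ G.B u
  · have hsnd : ¬ G.Anc w (G.snd e) := by
      have hw' := (hB ▸ heB : e ∈ G.B w).2.2
      exact not_anc_of_lt (lt_of_le_of_ne hw'.1.le hw'.2)
    exact iff_of_false (fun h => h.2 heB.2.1) fun h => hsnd h.1
  · rw [anc_fst_iff_anc_snd he.1 (hB ▸ heB), anc_fst_iff_anc_snd he.2 heB]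

theorem IsM.anc {u m : Fin G.n} (hm : G.IsM u m) : G.Anc u m :=
  hm.2 u fun _ ⟨_, he, hx⟩ => hx ▸ he.2.1

theorem B_subset_of_high_lt {u v h : Fin G.n} (hanc : G.Anc v u) (hh : G.IsHigh u h)
    (hlt : h < v) : G.B u ⊆ G.B v := by
  intro e he
  have hsv : G.snd e < v := (hh.2 e he).trans_lt hlt
  exact ⟨he.1, hanc.trans he.2.1, he.2.2.1.of_le hanc hsv.le, hsv.ne⟩

theorem exists_isHigh {u : Fin G.n} (hB : (G.B u).Nonempty) : ∃ h, G.IsHigh u h := by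
  have := G.edgeFintype
  obtain ⟨e, he, hmax⟩ := (G.B u).toFinite.exists_maximalFor G.snd _ hB
  exact ⟨G.snd e, ⟨e, he, rfl⟩, fun f hf => (le_total _ _).elim id (hmax hf)⟩

/-- If `B u ⊆ B v`, then `u` is the minimum vertex of `M⁻¹(M u)` greater than `v`. -/
theorem le_of_isM_of_B_subset (h3 : G.EdgeConn 3) {u v w m : Fin G.n} (hanc : G.Anc v u)
    (hsub : G.B u ⊆ G.B v) (hu : G.IsM u m) (hw : G.IsM w m) (hvw : v < w) : u ≤ w := by
  by_contra! hlt
  have hwu : G.Anc w u := hw.anc.of_le hu.anc hlt.le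
  have hvw' : G.Anc v w := hanc.of_le hwu hvw.le
  have hwr : w ≠ G.root := ((G.root_le v).trans_lt hvw).ne'
  refine B_ne_of_lt h3 hwr hlt (Set.Subset.antisymm (fun e he => ?_) fun e he => ?_)
  · exact ⟨he.1, hu.anc.trans (hw.1 _ ⟨e, he, rfl⟩), he.2.2.1.trans hwu,
      ((lt_of_le_of_ne he.2.2.1.le he.2.2.2).trans hlt).ne⟩
  · have hs := (hsub he).2.2
    exact ⟨he.1, hwu.trans he.2.1, hs.1.trans hvw', (hs.1.le.trans_lt hvw).ne⟩

end DFSGraph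

/-- Lemma 3.4: Let `G` be `3`-edge-connected with DFS tree `T` rooted
at `r`. Let `v ≠ r` be an ancestor of a vertex `u` such that `m = M(u)` satisfies
`m ∈ {M̃(v), M_low1(v), M_low2(v)}`. Then `v ∈ V(u)` if and only if `u` is the minimum
vertex in `M⁻¹(m)` greater than `v`, `high(u) < v`, and `b_count(v) = b_count(u) + 1`. -/
theorem stmt8 (G : DFSGraph) (h3 : G.EdgeConn 3) (u v m : Fin G.n)
    (hv : v ≠ G.root) (hanc : G.Anc v u)
    (hm : G.IsM u m)
    (hmem : G.IsMtilde v m ∨ G.IsMlow1 v m ∨ G.IsMlow2 v m) :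
    (∃ e, G.IsBack e ∧ e ∉ G.B u ∧ G.B v = insert e (G.B u)) ↔
      ((v < u ∧ ∀ u', v < u' → G.IsM u' m → u ≤ u') ∧
       (∃ h, G.IsHigh u h ∧ h < v) ∧
       G.bcount v = G.bcount u + 1) := by
  have := G.edgeFintype
  constructor
  · rintro ⟨e, -, heu, hB⟩
    have hsub : G.B u ⊆ G.B v := hB ▸ Set.subset_insert e (G.B u)
    have hvu : v < u := lt_of_le_of_ne hanc.le fun h => by
      subst h
      exact heu (hB ▸ Set.mem_insert e _)
    have hur : u ≠ G.root := ((G.root_le v).trans_lt hvu).ne'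
    obtain ⟨h, hh⟩ := DFSGraph.exists_isHigh
      (DFSGraph.B_nonempty (fun S hS => h3 S (hS.trans (by norm_num))) hur)
    refine ⟨⟨hvu, fun w hvw hw => DFSGraph.le_of_isM_of_B_subset h3 hanc hsub hm hw hvw⟩,
      ⟨h, hh, ?_⟩, ?_⟩
    · obtain ⟨f, hf, rfl⟩ := hh.1
      have hs := (hsub hf).2.2
      exact lt_of_le_of_ne hs.1.le hs.2
    · rw [DFSGraph.bcount, DFSGraph.bcount, hB, Set.ncard_insert_of_notMem heu]
  · rintro ⟨-, ⟨h, hh, hlt⟩, hcount⟩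
    obtain ⟨e, heu, hB⟩ := (Set.exists_eq_insert_iff_ncard (G.B u).toFinite).2
      ⟨DFSGraph.B_subset_of_high_lt hanc hh hlt, hcount.symm⟩
    exact ⟨e, (hB ▸ Set.mem_insert e _ : e ∈ G.B v).1, heu, hB.symm⟩
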